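/- arXiv:2312.01452 — 2 statements merged into one kernel-verified Lean document; each statement's English description precedes it below -/
import Mathlib

section
/- Define e₁(u,v) = 1666 sin(u) cos(v) + (245(cos(u) − e^{−u/5}) − 385 sin(u)) sin(v) − 1666 sin(u) e^{−3v/8} and e₂(u,v) = (−245(cos(u) − e^{−u/5}) + 385 sin(u)) cos(v) + 1666 sin(u) sin(v) + (−385 sin(u) − 245 cos(u) + 245 e^{u/5}) e^{−3v/8}. Then on the rectangle B₂ = [139/40, 219/50] × [47/100, 7/5] the following sign conditions hold: e₂(139/40, v) > 0 and e₂(219/50, v) < 0 for all v ∈ [47/100, 7/5], and e₁(u, 47/100) < 0 and e₁(u, 7/5) > 0 for all u ∈ [139/40, 219/50]. -/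
open Real

/-- The function `e₁(u,v)` from the Poincaré–Miranda proof of the existence of
three limit cycles. -/
noncomputable def e1 (u v : ℝ) : ℝ :=
  1666 * Real.sin u * Real.cos v
    + (245 * (Real.cos u - Real.exp (-u / 5)) - 385 * Real.sin u) * Real.sin v
    - 1666 * Real.sin u * Real.exp (-3 * v / 8)

/-- The function `e₂(u,v)` from the Poincaré–Miranda proof of the existence of
three limit cycles. -/
noncomputable def e2 (u v : ℝ) : ℝ :=
  (-245 * (Real.cos u - Real.exp (-u / 5)) + 385 * Real.sin u) * Real.cos v
    + 1666 * Real.sin u * Real.sin v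
    + (-385 * Real.sin u - 245 * Real.cos u + 245 * Real.exp (u / 5)) * Real.exp (-3 * v / 8)

lemma pm_sum (x : ℝ) (k : ℕ) :
    ∑ m ∈ Finset.range (2 * k), ((x : ℂ) * Complex.I) ^ m / (m.factorial : ℂ) =
      ((∑ j ∈ Finset.range k, (-1) ^ j * x ^ (2 * j) / ((2 * j).factorial : ℝ) : ℝ) : ℂ)
      + ((∑ j ∈ Finset.range k, (-1) ^ j * x ^ (2 * j + 1) / ((2 * j + 1).factorial : ℝ) : ℝ) : ℂ)
        * Complex.I := by
  induction k with
  | zero => simp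
  | succ k ih =>
    have h1 : Complex.I ^ (2 * k) = (-1) ^ k := by rw [pow_mul, Complex.I_sq]
    rw [show 2 * (k + 1) = 2 * k + 1 + 1 by ring, Finset.sum_range_succ, Finset.sum_range_succ, ih,
      Finset.sum_range_succ, Finset.sum_range_succ]
    simp only [mul_pow, pow_succ Complex.I, h1]
    push_cast
    ring

lemma pm_trig (x : ℝ) (k : ℕ) (hx : |x| / ((2 * k : ℕ).succ : ℝ) ≤ 1 / 2) :
    |cos x - ∑ j ∈ Finset.range k, (-1) ^ j * x ^ (2 * j) / ((2 * j).factorial : ℝ)|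
      ≤ |x| ^ (2 * k) / ((2 * k).factorial : ℝ) * 2 ∧
    |sin x - ∑ j ∈ Finset.range k, (-1) ^ j * x ^ (2 * j + 1) / ((2 * j + 1).factorial : ℝ)|
      ≤ |x| ^ (2 * k) / ((2 * k).factorial : ℝ) * 2 := by
  have hn : ‖(x : ℂ) * Complex.I‖ = |x| := by simp
  have h := Complex.exp_bound' (x := (x : ℂ) * Complex.I) (n := 2 * k) (by rw [hn]; exact hx)
  rw [pm_sum, hn] at h
  have hre := (Complex.abs_re_le_norm _).trans h
  have him := (Complex.abs_im_le_norm _).trans h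
  rw [Complex.sub_re, Complex.exp_ofReal_mul_I_re, Complex.add_re, Complex.re_ofReal_mul,
    Complex.ofReal_re, Complex.I_re, mul_zero, add_zero] at hre
  rw [Complex.sub_im, Complex.exp_ofReal_mul_I_im, Complex.add_im, Complex.im_ofReal_mul,
    Complex.ofReal_im, Complex.I_im, mul_one, zero_add] at him
  exact ⟨hre, him⟩

lemma pm_close {a S e q d : ℝ} (h : |a - S| ≤ e) (h' : |S - q| ≤ d - e) : |a - q| ≤ d := by
  have := abs_sub_le a S q
  linarith

lemma pm_mul {x y a b : ℝ} (hx : |x - a| ≤ 1 / 200) (hy : |y - b| ≤ 1 / 1000000)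
    (ha : |a| ≤ 1700) (hb : |b| ≤ 1) : |x * y - a * b| ≤ 1 / 100 := by
  have e : x * y - a * b = (x - a) * (y - b) + a * (y - b) + (x - a) * b := by ring
  rw [e]
  have h1 := abs_add_le ((x - a) * (y - b) + a * (y - b)) ((x - a) * b)
  have h2 := abs_add_le ((x - a) * (y - b)) (a * (y - b))
  rw [abs_mul, abs_mul] at h2
  rw [abs_mul (x - a) b] at h1
  have h3 : |x - a| * |y - b| ≤ 1 / 200 * (1 / 1000000) :=
    mul_le_mul hx hy (abs_nonneg _) (by norm_num)
  have h4 : |a| * |y - b| ≤ 1700 * (1 / 1000000) := mul_le_mul ha hy (abs_nonneg _) (by norm_num)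
  have h5 : |x - a| * |b| ≤ 1 / 200 * 1 := mul_le_mul hx hb (abs_nonneg _) (by norm_num)
  linarith

lemma pm_cos_u1 : |cos (139/40) - (-94493273 / 100000000)| ≤ 1 / 1000000 := by
  refine pm_close (pm_trig (139/40) 10 (by rw [abs_of_pos (by norm_num)]; norm_num)).1 ?_
  rw [abs_of_pos (show (0:ℝ) < (139/40) by norm_num), abs_le]
  constructor <;> norm_num [Finset.sum_range_succ, Nat.factorial]

lemma pm_sin_u1 : |sin (139/40) - (-32726464 / 100000000)| ≤ 1 / 1000000 := by
  refine pm_close (pm_trig (139/40) 10 (by rw [abs_of_pos (by norm_num)]; norm_num)).2 ?_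
  rw [abs_of_pos (show (0:ℝ) < (139/40) by norm_num), abs_le]
  constructor <;> norm_num [Finset.sum_range_succ, Nat.factorial]

lemma pm_cos_u2 : |cos (219/50) - (-32630218 / 100000000)| ≤ 1 / 1000000 := by
  refine pm_close (pm_trig (219/50) 12 (by rw [abs_of_pos (by norm_num)]; norm_num)).1 ?_
  rw [abs_of_pos (show (0:ℝ) < (219/50) by norm_num), abs_le]
  constructor <;> norm_num [Finset.sum_range_succ, Nat.factorial]

lemma pm_sin_u2 : |sin (219/50) - (-94526551 / 100000000)| ≤ 1 / 1000000 := by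
  refine pm_close (pm_trig (219/50) 12 (by rw [abs_of_pos (by norm_num)]; norm_num)).2 ?_
  rw [abs_of_pos (show (0:ℝ) < (219/50) by norm_num), abs_le]
  constructor <;> norm_num [Finset.sum_range_succ, Nat.factorial]

lemma pm_cos_v1 : |cos (47/100) - (89156829 / 100000000)| ≤ 1 / 1000000 := by
  refine pm_close (pm_trig (47/100) 7 (by rw [abs_of_pos (by norm_num)]; norm_num)).1 ?_
  rw [abs_of_pos (show (0:ℝ) < (47/100) by norm_num), abs_le]
  constructor <;> norm_num [Finset.sum_range_succ, Nat.factorial]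

lemma pm_sin_v1 : |sin (47/100) - (45288629 / 100000000)| ≤ 1 / 1000000 := by
  refine pm_close (pm_trig (47/100) 7 (by rw [abs_of_pos (by norm_num)]; norm_num)).2 ?_
  rw [abs_of_pos (show (0:ℝ) < (47/100) by norm_num), abs_le]
  constructor <;> norm_num [Finset.sum_range_succ, Nat.factorial]

lemma pm_cos_v2 : |cos (7/5) - (16996714 / 100000000)| ≤ 1 / 1000000 := by
  refine pm_close (pm_trig (7/5) 7 (by rw [abs_of_pos (by norm_num)]; norm_num)).1 ?_
  rw [abs_of_pos (show (0:ℝ) < (7/5) by norm_num), abs_le]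
  constructor <;> norm_num [Finset.sum_range_succ, Nat.factorial]

lemma pm_sin_v2 : |sin (7/5) - (98544973 / 100000000)| ≤ 1 / 1000000 := by
  refine pm_close (pm_trig (7/5) 7 (by rw [abs_of_pos (by norm_num)]; norm_num)).2 ?_
  rw [abs_of_pos (show (0:ℝ) < (7/5) by norm_num), abs_le]
  constructor <;> norm_num [Finset.sum_range_succ, Nat.factorial]

lemma pm_exp_mu1 : |exp (-(139/40) / 5) - (49907445 / 100000000)| ≤ 1 / 1000000 := by
  refine pm_close (Real.exp_bound (x := (-(139/40) / 5)) (n := 12) (by rw [abs_le]; norm_num) (by norm_num)) ?_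
  rw [abs_le]
  constructor <;> norm_num [Finset.sum_range_succ, Nat.factorial, abs_of_pos, abs_of_neg]

lemma pm_exp_pu1 : |exp ((139/40) / 5) - (200370907 / 100000000)| ≤ 1 / 1000000 := by
  refine pm_close (Real.exp_bound (x := ((139/40) / 5)) (n := 12) (by rw [abs_le]; norm_num) (by norm_num)) ?_
  rw [abs_le]
  constructor <;> norm_num [Finset.sum_range_succ, Nat.factorial, abs_of_pos, abs_of_neg]

lemma pm_exp_mu2 : |exp (-(219/50) / 5) - (41644537 / 100000000)| ≤ 1 / 1000000 := by
  refine pm_close (Real.exp_bound (x := (-(219/50) / 5)) (n := 12) (by rw [abs_le]; norm_num) (by norm_num)) ?_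
  rw [abs_le]
  constructor <;> norm_num [Finset.sum_range_succ, Nat.factorial, abs_of_pos, abs_of_neg]

lemma pm_exp_pu2 : |exp ((219/50) / 5) - (240127537 / 100000000)| ≤ 1 / 1000000 := by
  refine pm_close (Real.exp_bound (x := ((219/50) / 5)) (n := 12) (by rw [abs_le]; norm_num) (by norm_num)) ?_
  rw [abs_le]
  constructor <;> norm_num [Finset.sum_range_succ, Nat.factorial, abs_of_pos, abs_of_neg]

lemma pm_exp_v1 : |exp (-3 * (47/100) / 8) - (83840836 / 100000000)| ≤ 1 / 1000000 := by
  refine pm_close (Real.exp_bound (x := (-3 * (47/100) / 8)) (n := 12) (by rw [abs_le]; norm_num) (by norm_num)) ?_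
  rw [abs_le]
  constructor <;> norm_num [Finset.sum_range_succ, Nat.factorial, abs_of_pos, abs_of_neg]

lemma pm_exp_v2 : |exp (-3 * (7/5) / 8) - (59155536 / 100000000)| ≤ 1 / 1000000 := by
  refine pm_close (Real.exp_bound (x := (-3 * (7/5) / 8)) (n := 12) (by rw [abs_le]; norm_num) (by norm_num)) ?_
  rw [abs_le]
  constructor <;> norm_num [Finset.sum_range_succ, Nat.factorial, abs_of_pos, abs_of_neg]

lemma pm_a_u1 : |-245 * (cos (139/40) - exp (-(139/40) / 5)) + 385 * sin (139/40) - (22778487338 / 100000000)| ≤ 1 / 200 := by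
  have h1 := abs_le.1 pm_cos_u1
  have h2 := abs_le.1 pm_sin_u1
  have h3 := abs_le.1 pm_exp_mu1
  have h4 := abs_le.1 pm_exp_pu1
  rw [abs_le]
  constructor <;> linarith [h1.1, h1.2, h2.1, h2.2, h3.1, h3.2, h4.1, h4.2]

lemma pm_b_u1 : |1666 * sin (139/40) - (-54522288203 / 100000000)| ≤ 1 / 200 := by
  have h1 := abs_le.1 pm_cos_u1
  have h2 := abs_le.1 pm_sin_u1
  have h3 := abs_le.1 pm_exp_mu1
  have h4 := abs_le.1 pm_exp_pu1
  rw [abs_le]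
  constructor <;> linarith [h1.1, h1.2, h2.1, h2.2, h3.1, h3.2, h4.1, h4.2]

lemma pm_c_u1 : |-385 * sin (139/40) - 245 * cos (139/40) + 245 * exp ((139/40) / 5) - (84841412574 / 100000000)| ≤ 1 / 200 := by
  have h1 := abs_le.1 pm_cos_u1
  have h2 := abs_le.1 pm_sin_u1
  have h3 := abs_le.1 pm_exp_mu1
  have h4 := abs_le.1 pm_exp_pu1
  rw [abs_le]
  constructor <;> linarith [h1.1, h1.2, h2.1, h2.2, h3.1, h3.2, h4.1, h4.2]

lemma pm_a_u2 : |-245 * (cos (219/50) - exp (-(219/50) / 5)) + 385 * sin (219/50) - (-18195407387 / 100000000)| ≤ 1 / 200 := by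
  have h1 := abs_le.1 pm_cos_u2
  have h2 := abs_le.1 pm_sin_u2
  have h3 := abs_le.1 pm_exp_mu2
  have h4 := abs_le.1 pm_exp_pu2
  rw [abs_le]
  constructor <;> linarith [h1.1, h1.2, h2.1, h2.2, h3.1, h3.2, h4.1, h4.2]

lemma pm_b_u2 : |1666 * sin (219/50) - (-157481234331 / 100000000)| ≤ 1 / 200 := by
  have h1 := abs_le.1 pm_cos_u2
  have h2 := abs_le.1 pm_sin_u2
  have h3 := abs_le.1 pm_exp_mu2
  have h4 := abs_le.1 pm_exp_pu2
  rw [abs_le]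
  constructor <;> linarith [h1.1, h1.2, h2.1, h2.2, h3.1, h3.2, h4.1, h4.2]

lemma pm_c_u2 : |-385 * sin (219/50) - 245 * cos (219/50) + 245 * exp ((219/50) / 5) - (103218372127 / 100000000)| ≤ 1 / 200 := by
  have h1 := abs_le.1 pm_cos_u2
  have h2 := abs_le.1 pm_sin_u2
  have h3 := abs_le.1 pm_exp_mu2
  have h4 := abs_le.1 pm_exp_pu2
  rw [abs_le]
  constructor <;> linarith [h1.1, h1.2, h2.1, h2.2, h3.1, h3.2, h4.1, h4.2]

lemma pm_A_v1 : |1666 * cos (47/100) - 385 * sin (47/100) - 1666 * exp (-3 * (47/100) / 8) - (-8579677124 / 100000000)| ≤ 1 / 200 := by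
  have h1 := abs_le.1 pm_cos_v1
  have h2 := abs_le.1 pm_sin_v1
  have h3 := abs_le.1 pm_exp_v1
  rw [abs_le]
  constructor <;> linarith [h1.1, h1.2, h2.1, h2.2, h3.1, h3.2]

lemma pm_B_v1 : |245 * sin (47/100) - (11095713992 / 100000000)| ≤ 1 / 200 := by
  have h1 := abs_le.1 pm_cos_v1
  have h2 := abs_le.1 pm_sin_v1
  have h3 := abs_le.1 pm_exp_v1
  rw [abs_le]
  constructor <;> linarith [h1.1, h1.2, h2.1, h2.2, h3.1, h3.2]

lemma pm_A_v2 : |1666 * cos (7/5) - 385 * sin (7/5) - 1666 * exp (-3 * (7/5) / 8) - (-108176412301 / 100000000)| ≤ 1 / 200 := by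
  have h1 := abs_le.1 pm_cos_v2
  have h2 := abs_le.1 pm_sin_v2
  have h3 := abs_le.1 pm_exp_v2
  rw [abs_le]
  constructor <;> linarith [h1.1, h1.2, h2.1, h2.2, h3.1, h3.2]

lemma pm_B_v2 : |245 * sin (7/5) - (24143518385 / 100000000)| ≤ 1 / 200 := by
  have h1 := abs_le.1 pm_cos_v2
  have h2 := abs_le.1 pm_sin_v2
  have h3 := abs_le.1 pm_exp_v2
  rw [abs_le]
  constructor <;> linarith [h1.1, h1.2, h2.1, h2.2, h3.1, h3.2]

lemma pm_e2_1 : 0 < e2 (139/40) (7/5) := by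
  have h1 := abs_le.1 (pm_mul pm_a_u1 pm_cos_v2 (by rw [abs_le]; norm_num) (by rw [abs_le]; norm_num))
  have h2 := abs_le.1 (pm_mul pm_b_u1 pm_sin_v2 (by rw [abs_le]; norm_num) (by rw [abs_le]; norm_num))
  have h3 := abs_le.1 (pm_mul pm_c_u1 pm_exp_v2 (by rw [abs_le]; norm_num) (by rw [abs_le]; norm_num))
  unfold e2
  linarith [h1.1, h2.1, h3.1]

lemma pm_e2_2 : e2 (219/50) (47/100) < 0 := by
  have h1 := abs_le.1 (pm_mul pm_a_u2 pm_cos_v1 (by rw [abs_le]; norm_num) (by rw [abs_le]; norm_num))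
  have h2 := abs_le.1 (pm_mul pm_b_u2 pm_sin_v1 (by rw [abs_le]; norm_num) (by rw [abs_le]; norm_num))
  have h3 := abs_le.1 (pm_mul pm_c_u2 pm_exp_v1 (by rw [abs_le]; norm_num) (by rw [abs_le]; norm_num))
  unfold e2
  linarith [h1.2, h2.2, h3.2]

lemma pm_e1_1 : e1 (219/50) (47/100) < 0 := by
  have h1 := abs_le.1 (pm_mul pm_A_v1 pm_sin_u2 (by rw [abs_le]; norm_num) (by rw [abs_le]; norm_num))
  have h2 := abs_le.1 (pm_mul pm_B_v1 pm_cos_u2 (by rw [abs_le]; norm_num) (by rw [abs_le]; norm_num))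
  have h3 := abs_le.1 (pm_mul pm_B_v1 pm_exp_mu2 (by rw [abs_le]; norm_num) (by rw [abs_le]; norm_num))
  unfold e1
  linarith [h1.2, h2.2, h3.1]

lemma pm_e1_2 : 0 < e1 (139/40) (7/5) := by
  have h1 := abs_le.1 (pm_mul pm_A_v2 pm_sin_u1 (by rw [abs_le]; norm_num) (by rw [abs_le]; norm_num))
  have h2 := abs_le.1 (pm_mul pm_B_v2 pm_cos_u1 (by rw [abs_le]; norm_num) (by rw [abs_le]; norm_num))
  have h3 := abs_le.1 (pm_mul pm_B_v2 pm_exp_mu1 (by rw [abs_le]; norm_num) (by rw [abs_le]; norm_num))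
  unfold e1
  linarith [h1.1, h2.1, h3.2]

lemma pm_mono {v u w : ℝ}
    (hA : 1666 * cos v - 385 * sin v - 1666 * exp (-3 * v / 8) ≤ 0) (hB : 0 ≤ 245 * sin v)
    (h1 : 3.15 ≤ u) (h2 : u ≤ w) (h3 : w ≤ 4.5) : e1 u v ≤ e1 w v := by
  have p1 := pi_gt_d2
  have p2 := pi_lt_d2
  have hs : sin w ≤ sin u := by
    have := sin_le_sin_of_le_of_le_pi_div_two (x := u - π) (y := w - π) (by linarith)
      (by linarith) (by linarith)
    rw [sin_sub_pi, sin_sub_pi] at this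
    linarith
  have hc : cos u ≤ cos w := by
    have := cos_le_cos_of_nonneg_of_le_pi (x := u - π) (y := w - π) (by linarith)
      (by linarith) (by linarith)
    rw [cos_sub_pi, cos_sub_pi] at this
    linarith
  have he : exp (-w / 5) ≤ exp (-u / 5) := exp_le_exp.2 (by linarith)
  have q1 := mul_le_mul_of_nonpos_left hs hA
  have q2 := mul_le_mul_of_nonneg_left hc hB
  have q3 := mul_le_mul_of_nonneg_left he hB
  unfold e1
  linarith

lemma pm_part1 (v : ℝ) (h1 : 47/100 ≤ v) (h2 : v ≤ 7/5) : 0 < e2 (139/40) v := by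
  have p1 := pi_gt_d2
  refine pm_e2_1.trans_le ?_
  have hs : sin v ≤ sin (7/5) :=
    sin_le_sin_of_le_of_le_pi_div_two (by linarith) (by linarith) h2
  have hc : cos (7/5) ≤ cos v := cos_le_cos_of_nonneg_of_le_pi (by linarith) (by linarith) h2
  have he : exp (-3 * (7/5) / 8) ≤ exp (-3 * v / 8) := exp_le_exp.2 (by linarith)
  have q1 := mul_le_mul_of_nonneg_left hc (a := -245 * (cos (139/40) - exp (-(139/40) / 5)) + 385 * sin (139/40)) (by linarith [(abs_le.1 pm_a_u1).1])
  have q2 := mul_le_mul_of_nonpos_left hs (c := 1666 * sin (139/40))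
    (by linarith [(abs_le.1 pm_b_u1).2])
  have q3 := mul_le_mul_of_nonneg_left he (a := -385 * sin (139/40) - 245 * cos (139/40) + 245 * exp ((139/40) / 5)) (by linarith [(abs_le.1 pm_c_u1).1])
  unfold e2
  linarith

lemma pm_part2 (v : ℝ) (h1 : 47/100 ≤ v) (h2 : v ≤ 7/5) : e2 (219/50) v < 0 := by
  have p1 := pi_gt_d2
  refine lt_of_le_of_lt ?_ pm_e2_2
  obtain ⟨s, rfl⟩ : ∃ s, v = 47/100 + s := ⟨v - 47/100, by ring⟩
  have hs : 0 ≤ sin s := sin_nonneg_of_nonneg_of_le_pi (by linarith) (by linarith)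
  have hc : 0 ≤ cos s := cos_nonneg_of_neg_pi_div_two_le_of_le (by linarith) (by linarith)
  have hsc : 1 ≤ cos s + sin s := by nlinarith [sin_sq_add_cos_sq s, sin_le_one s, cos_le_one s]
  have he : exp (-3 * (47/100 + s) / 8) ≤ exp (-3 * (47/100) / 8) := exp_le_exp.2 (by linarith)
  have q3 := mul_le_mul_of_nonneg_left he (a := -385 * sin (219/50) - 245 * cos (219/50) + 245 * exp ((219/50) / 5)) (by linarith [(abs_le.1 pm_c_u2).1])
  have k1 := abs_le.1 (pm_mul pm_a_u2 pm_cos_v1 (by rw [abs_le]; norm_num) (by rw [abs_le]; norm_num))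
  have k2 := abs_le.1 (pm_mul pm_b_u2 pm_sin_v1 (by rw [abs_le]; norm_num) (by rw [abs_le]; norm_num))
  have k3 := abs_le.1 (pm_mul pm_a_u2 pm_sin_v1 (by rw [abs_le]; norm_num) (by rw [abs_le]; norm_num))
  have k4 := abs_le.1 (pm_mul pm_b_u2 pm_cos_v1 (by rw [abs_le]; norm_num) (by rw [abs_le]; norm_num))
  unfold e2
  rw [cos_add, sin_add]
  generalize -245 * (cos (219/50) - exp (-(219/50) / 5)) + 385 * sin (219/50) = a at *
  generalize 1666 * sin (219/50) = b at *
  generalize cos (47/100) = c at *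
  generalize sin (47/100) = d at *
  have r1 : b * c - a * d ≤ a * c + b * d := by linarith [k1.1, k2.1, k3.1, k4.2]
  have r2 : a * c + b * d ≤ 0 := by linarith [k1.2, k2.2]
  have t1 := mul_le_mul_of_nonneg_right r1 hs
  have t2 := mul_le_mul_of_nonpos_left hsc r2
  linarith

theorem poincare_miranda_signs_B2 :
    (∀ v ∈ Set.Icc (47/100 : ℝ) (7/5), 0 < e2 (139/40) v ∧ e2 (219/50) v < 0) ∧
    (∀ u ∈ Set.Icc (139/40 : ℝ) (219/50), e1 u (47/100) < 0 ∧ 0 < e1 u (7/5)) := by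
  refine ⟨fun v hv => ⟨pm_part1 v hv.1 hv.2, pm_part2 v hv.1 hv.2⟩, fun u hu => ⟨?_, ?_⟩⟩
  · refine lt_of_le_of_lt (pm_mono ?_ ?_ ?_ hu.2 ?_) pm_e1_1
    · linarith [(abs_le.1 pm_A_v1).2]
    · linarith [(abs_le.1 pm_B_v1).1]
    · linarith [hu.1]
    · norm_num
  · refine pm_e1_2.trans_le (pm_mono ?_ ?_ ?_ hu.1 ?_)
    · linarith [(abs_le.1 pm_A_v2).2]
    · linarith [(abs_le.1 pm_B_v2).1]
    · norm_num
    · linarith [hu.2]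
end

section
/- Define e₁(u,v) = 1666 sin(u) cos(v) + (245(cos(u) − e^{−u/5}) − 385 sin(u)) sin(v) − 1666 sin(u) e^{−3v/8} and e₂(u,v) = (−245(cos(u) − e^{−u/5}) + 385 sin(u)) cos(v) + 1666 sin(u) sin(v) + (−385 sin(u) − 245 cos(u) + 245 e^{u/5}) e^{−3v/8}. Then there exists a point (u, v) in the open rectangle (17/5, 139/40) × (7/5, 41/25) with e₁(u, v) = 0 and e₂(u, v) = 0. -/
open Real

lemma trig_bound (x : ℝ) (h0 : 0 ≤ x) (h1 : x ≤ 10) :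
    |Real.cos x - (1 - x^2/2 + x^4/24 - x^6/720 + x^8/40320 - x^10/3628800 + x^12/479001600
      - x^14/87178291200 + x^16/20922789888000 - x^18/6402373705728000)|
      ≤ x^20/2432902008176640000*2 ∧
    |Real.sin x - (x - x^3/6 + x^5/120 - x^7/5040 + x^9/362880 - x^11/39916800 + x^13/6227020800
      - x^15/1307674368000 + x^17/355687428096000 - x^19/121645100408832000)|
      ≤ x^20/2432902008176640000*2 := by
  have hn : ‖(x : ℂ) * Complex.I‖ = x := by simp [abs_of_nonneg h0]
  have h := Complex.exp_bound' (x := (x : ℂ) * Complex.I) (n := 20) (by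
    rw [hn]; push_cast; linarith)
  rw [hn] at h
  have hf : ((Nat.factorial 20 : ℕ) : ℝ) = 2432902008176640000 := by norm_num [Nat.factorial]
  rw [hf] at h
  have key : Complex.exp (x * Complex.I) - ∑ m ∈ Finset.range 20, ((x : ℂ) * Complex.I) ^ m / m.factorial
      = ((Real.cos x - (1 - x^2/2 + x^4/24 - x^6/720 + x^8/40320 - x^10/3628800 + x^12/479001600
      - x^14/87178291200 + x^16/20922789888000 - x^18/6402373705728000) : ℝ) : ℂ)
      + ((Real.sin x - (x - x^3/6 + x^5/120 - x^7/5040 + x^9/362880 - x^11/39916800 + x^13/6227020800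
      - x^15/1307674368000 + x^17/355687428096000 - x^19/121645100408832000) : ℝ) : ℂ) * Complex.I := by
    have hI : ∀ k : ℕ, Complex.I ^ (k + 2) = - Complex.I ^ k := by
      intro k; rw [pow_add, Complex.I_sq]; ring
    rw [Complex.exp_mul_I]
    simp only [Finset.sum_range_succ, Finset.sum_range_zero, Nat.factorial, mul_pow, hI]
    push_cast
    ring
  rw [key] at h
  constructor
  · refine le_trans ?_ h
    refine le_trans (le_of_eq ?_) (Complex.abs_re_le_norm _)
    congr 1
    simp only [Complex.add_re, Complex.re_ofReal_mul, Complex.ofReal_re, Complex.I_re]; ring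
  · refine le_trans ?_ h
    refine le_trans (le_of_eq ?_) (Complex.abs_im_le_norm _)
    congr 1
    simp only [Complex.add_im, Complex.im_ofReal_mul, Complex.ofReal_im, Complex.I_im]; ring

lemma cos_near (x c : ℝ) (h0 : 0 ≤ x) (h1 : x ≤ 10)
    (h : |(1 - x^2/2 + x^4/24 - x^6/720 + x^8/40320 - x^10/3628800 + x^12/479001600
      - x^14/87178291200 + x^16/20922789888000 - x^18/6402373705728000) - c|
      + x^20/2432902008176640000*2 ≤ 1/1000000) : |Real.cos x - c| ≤ 1/1000000 := by
  have := (trig_bound x h0 h1).1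
  have h2 := abs_sub_le (Real.cos x) (1 - x^2/2 + x^4/24 - x^6/720 + x^8/40320 - x^10/3628800
    + x^12/479001600 - x^14/87178291200 + x^16/20922789888000 - x^18/6402373705728000) c
  linarith

lemma sin_near (x c : ℝ) (h0 : 0 ≤ x) (h1 : x ≤ 10)
    (h : |(x - x^3/6 + x^5/120 - x^7/5040 + x^9/362880 - x^11/39916800 + x^13/6227020800
      - x^15/1307674368000 + x^17/355687428096000 - x^19/121645100408832000) - c|
      + x^20/2432902008176640000*2 ≤ 1/1000000) : |Real.sin x - c| ≤ 1/1000000 := by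
  have := (trig_bound x h0 h1).2
  have h2 := abs_sub_le (Real.sin x) (x - x^3/6 + x^5/120 - x^7/5040 + x^9/362880 - x^11/39916800
    + x^13/6227020800 - x^15/1307674368000 + x^17/355687428096000 - x^19/121645100408832000) c
  linarith

lemma exp_near (x c : ℝ) (h1 : |x| ≤ 1)
    (h : |(1 + x + x^2/2 + x^3/6 + x^4/24 + x^5/120 + x^6/720 + x^7/5040 + x^8/40320
      + x^9/362880) - c| + |x|^10*(11/36288000) ≤ 1/1000000) : |Real.exp x - c| ≤ 1/1000000 := by
  have := Real.exp_bound h1 (n := 10) (by norm_num)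
  have e : ∑ m ∈ Finset.range 10, x ^ m / (m.factorial : ℝ) =
      1 + x + x^2/2 + x^3/6 + x^4/24 + x^5/120 + x^6/720 + x^7/5040 + x^8/40320
      + x^9/362880 := by
    simp only [Finset.sum_range_succ, Finset.sum_range_zero, Nat.factorial]
    push_cast; ring
  rw [e] at this
  have e2 : ((Nat.succ 10 : ℕ) : ℝ) / ((Nat.factorial 10 : ℕ) * ((10 : ℕ) : ℝ)) = 11/36288000 := by
    norm_num [Nat.factorial]
  rw [e2] at this
  have h2 := abs_sub_le (Real.exp x) (1 + x + x^2/2 + x^3/6 + x^4/24 + x^5/120 + x^6/720 + x^7/5040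
    + x^8/40320 + x^9/362880) c
  linarith

lemma mul_near (x y a b : ℝ) (hx : |x - a| ≤ 1/1000000) (hy : |y - b| ≤ 1/1000000)
    (ha : |a| ≤ 21/10) (hb : |b| ≤ 21/10) : |x * y - a * b| ≤ 5/1000000 := by
  have e : x * y - a * b = (x - a) * (y - b) + a * (y - b) + (x - a) * b := by ring
  rw [e]
  refine le_trans (abs_add_three _ _ _) ?_
  rw [abs_mul, abs_mul, abs_mul]
  have h1 := mul_le_mul hx hy (abs_nonneg _) (by norm_num)
  have h2 := mul_le_mul ha hy (abs_nonneg _) (by norm_num)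
  have h3 := mul_le_mul hx hb (abs_nonneg _) (by norm_num)
  linarith

lemma suA : |Real.sin (17/5) - (-2555411/10000000)| ≤ 1/1000000 := by
  apply sin_near _ _ (by norm_num) (by norm_num)
  norm_num [abs_of_nonneg, abs_of_neg]

lemma cuA : |Real.cos (17/5) - (-9667982/10000000)| ≤ 1/1000000 := by
  apply cos_near _ _ (by norm_num) (by norm_num)
  norm_num [abs_of_nonneg, abs_of_neg]

lemma svA : |Real.sin (41/25) - (9976064/10000000)| ≤ 1/1000000 := by
  apply sin_near _ _ (by norm_num) (by norm_num)
  norm_num [abs_of_nonneg, abs_of_neg]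

lemma cvA : |Real.cos (41/25) - (-691484/10000000)| ≤ 1/1000000 := by
  apply cos_near _ _ (by norm_num) (by norm_num)
  norm_num [abs_of_nonneg, abs_of_neg]

lemma emA : |Real.exp (-(17/5) / 5) - (5066170/10000000)| ≤ 1/1000000 := by
  apply exp_near _ _ (by rw [abs_le]; norm_num)
  norm_num [abs_le, abs_of_nonneg, abs_of_neg]

lemma epA : |Real.exp ((17/5) / 5) - (19738777/10000000)| ≤ 1/1000000 := by
  apply exp_near _ _ (by rw [abs_le]; norm_num)
  norm_num [abs_le, abs_of_nonneg, abs_of_neg]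

lemma evA : |Real.exp (-3 * (41/25) / 8) - (5406409/10000000)| ≤ 1/1000000 := by
  apply exp_near _ _ (by rw [abs_le]; norm_num)
  norm_num [abs_le, abs_of_nonneg, abs_of_neg]

lemma corner_e1_A : e1 (17/5) (41/25) < 0 := by
  unfold e1
  have h0 := abs_le.1 (mul_near _ _ _ _ suA cvA (by rw [abs_le]; norm_num) (by rw [abs_le]; norm_num))
  have h1 := abs_le.1 (mul_near _ _ _ _ cuA svA (by rw [abs_le]; norm_num) (by rw [abs_le]; norm_num))
  have h2 := abs_le.1 (mul_near _ _ _ _ emA svA (by rw [abs_le]; norm_num) (by rw [abs_le]; norm_num))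
  have h3 := abs_le.1 (mul_near _ _ _ _ suA svA (by rw [abs_le]; norm_num) (by rw [abs_le]; norm_num))
  have h4 := abs_le.1 (mul_near _ _ _ _ suA evA (by rw [abs_le]; norm_num) (by rw [abs_le]; norm_num))
  nlinarith only [h0.1, h0.2, h1.1, h1.2, h2.1, h2.2, h3.1, h3.2, h4.1, h4.2]

lemma corner_e2_A : e2 (17/5) (41/25) < 0 := by
  unfold e2
  have h0 := abs_le.1 (mul_near _ _ _ _ cuA cvA (by rw [abs_le]; norm_num) (by rw [abs_le]; norm_num))
  have h1 := abs_le.1 (mul_near _ _ _ _ emA cvA (by rw [abs_le]; norm_num) (by rw [abs_le]; norm_num))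
  have h2 := abs_le.1 (mul_near _ _ _ _ suA cvA (by rw [abs_le]; norm_num) (by rw [abs_le]; norm_num))
  have h3 := abs_le.1 (mul_near _ _ _ _ suA svA (by rw [abs_le]; norm_num) (by rw [abs_le]; norm_num))
  have h4 := abs_le.1 (mul_near _ _ _ _ suA evA (by rw [abs_le]; norm_num) (by rw [abs_le]; norm_num))
  have h5 := abs_le.1 (mul_near _ _ _ _ cuA evA (by rw [abs_le]; norm_num) (by rw [abs_le]; norm_num))
  have h6 := abs_le.1 (mul_near _ _ _ _ epA evA (by rw [abs_le]; norm_num) (by rw [abs_le]; norm_num))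
  nlinarith only [h0.1, h0.2, h1.1, h1.2, h2.1, h2.2, h3.1, h3.2, h4.1, h4.2, h5.1, h5.2, h6.1, h6.2]

lemma suB : |Real.sin (139/40) - (-3272646/10000000)| ≤ 1/1000000 := by
  apply sin_near _ _ (by norm_num) (by norm_num)
  norm_num [abs_of_nonneg, abs_of_neg]

lemma cuB : |Real.cos (139/40) - (-9449327/10000000)| ≤ 1/1000000 := by
  apply cos_near _ _ (by norm_num) (by norm_num)
  norm_num [abs_of_nonneg, abs_of_neg]

lemma svB : |Real.sin (7/5) - (9854497/10000000)| ≤ 1/1000000 := by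
  apply sin_near _ _ (by norm_num) (by norm_num)
  norm_num [abs_of_nonneg, abs_of_neg]

lemma cvB : |Real.cos (7/5) - (1699671/10000000)| ≤ 1/1000000 := by
  apply cos_near _ _ (by norm_num) (by norm_num)
  norm_num [abs_of_nonneg, abs_of_neg]

lemma emB : |Real.exp (-(139/40) / 5) - (4990744/10000000)| ≤ 1/1000000 := by
  apply exp_near _ _ (by rw [abs_le]; norm_num)
  norm_num [abs_le, abs_of_nonneg, abs_of_neg]

lemma epB : |Real.exp ((139/40) / 5) - (20037091/10000000)| ≤ 1/1000000 := by
  apply exp_near _ _ (by rw [abs_le]; norm_num)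
  norm_num [abs_le, abs_of_nonneg, abs_of_neg]

lemma evB : |Real.exp (-3 * (7/5) / 8) - (5915554/10000000)| ≤ 1/1000000 := by
  apply exp_near _ _ (by rw [abs_le]; norm_num)
  norm_num [abs_le, abs_of_nonneg, abs_of_neg]

lemma corner_e1_B : e1 (139/40) (7/5) > 0 := by
  unfold e1
  have h0 := abs_le.1 (mul_near _ _ _ _ suB cvB (by rw [abs_le]; norm_num) (by rw [abs_le]; norm_num))
  have h1 := abs_le.1 (mul_near _ _ _ _ cuB svB (by rw [abs_le]; norm_num) (by rw [abs_le]; norm_num))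
  have h2 := abs_le.1 (mul_near _ _ _ _ emB svB (by rw [abs_le]; norm_num) (by rw [abs_le]; norm_num))
  have h3 := abs_le.1 (mul_near _ _ _ _ suB svB (by rw [abs_le]; norm_num) (by rw [abs_le]; norm_num))
  have h4 := abs_le.1 (mul_near _ _ _ _ suB evB (by rw [abs_le]; norm_num) (by rw [abs_le]; norm_num))
  nlinarith only [h0.1, h0.2, h1.1, h1.2, h2.1, h2.2, h3.1, h3.2, h4.1, h4.2]

lemma corner_e2_B : e2 (139/40) (7/5) > 0 := by
  unfold e2
  have h0 := abs_le.1 (mul_near _ _ _ _ cuB cvB (by rw [abs_le]; norm_num) (by rw [abs_le]; norm_num))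
  have h1 := abs_le.1 (mul_near _ _ _ _ emB cvB (by rw [abs_le]; norm_num) (by rw [abs_le]; norm_num))
  have h2 := abs_le.1 (mul_near _ _ _ _ suB cvB (by rw [abs_le]; norm_num) (by rw [abs_le]; norm_num))
  have h3 := abs_le.1 (mul_near _ _ _ _ suB svB (by rw [abs_le]; norm_num) (by rw [abs_le]; norm_num))
  have h4 := abs_le.1 (mul_near _ _ _ _ suB evB (by rw [abs_le]; norm_num) (by rw [abs_le]; norm_num))
  have h5 := abs_le.1 (mul_near _ _ _ _ cuB evB (by rw [abs_le]; norm_num) (by rw [abs_le]; norm_num))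
  have h6 := abs_le.1 (mul_near _ _ _ _ epB evB (by rw [abs_le]; norm_num) (by rw [abs_le]; norm_num))
  nlinarith only [h0.1, h0.2, h1.1, h1.2, h2.1, h2.2, h3.1, h3.2, h4.1, h4.2, h5.1, h5.2, h6.1, h6.2]

lemma u_bounds (u : ℝ) (h : u ∈ Set.Icc (17/5 : ℝ) (139/40)) :
    -34/100 ≤ Real.sin u ∧ Real.sin u ≤ -18/100 ∧ -1 ≤ Real.cos u ∧ Real.cos u ≤ -89/100 ∧
    Real.exp (-u/5) ≤ 1 ∧ 0 < Real.exp (-u/5) ∧ 0 < Real.exp (u/5) ∧ Real.exp (u/5) ≤ 21/10 := by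
  obtain ⟨h1, h2⟩ := h
  have hd : |u - 17/5| ≤ 75/1000 := by rw [abs_le]; constructor <;> linarith
  have a := abs_le.1 ((Real.abs_sin_sub_sin_le u (17/5)).trans hd)
  have b := abs_le.1 ((Real.abs_cos_sub_cos_le u (17/5)).trans hd)
  have a' := abs_le.1 suA
  have b' := abs_le.1 cuA
  have c' := abs_le.1 epB
  have c := Real.exp_le_exp.2 (show u/5 ≤ (139/40)/5 by linarith)
  refine ⟨?_, by linarith, Real.neg_one_le_cos u, by linarith, ?_, Real.exp_pos _, Real.exp_pos _,
    by linarith⟩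
  · linarith
  · rw [Real.exp_le_one_iff]; linarith

lemma v_bounds (v : ℝ) (h : v ∈ Set.Icc (7/5 : ℝ) (41/25)) :
    98/100 ≤ Real.sin v ∧ Real.sin v ≤ 1 ∧ -7/100 ≤ Real.cos v ∧ Real.cos v ≤ 171/1000 ∧
    54/100 ≤ Real.exp (-3*v/8) ∧ Real.exp (-3*v/8) ≤ 6/10 := by
  obtain ⟨h1, h2⟩ := h
  have hpi := Real.pi_gt_three
  have a := Real.cos_le_cos_of_nonneg_of_le_pi (x := 7/5) (y := v) (by norm_num) (by linarith) h1
  have b := Real.cos_le_cos_of_nonneg_of_le_pi (x := v) (y := 41/25) (by linarith) (by linarith) h2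
  have a' := abs_le.1 cvA
  have b' := abs_le.1 cvB
  have c := Real.exp_le_exp.2 (show -3*v/8 ≤ -3*(7/5)/8 by linarith)
  have d := Real.exp_le_exp.2 (show -3*(41/25)/8 ≤ -3*v/8 by linarith)
  have c' := abs_le.1 evA
  have d' := abs_le.1 evB
  have hs : 0 < Real.sin v := Real.sin_pos_of_pos_of_lt_pi (by linarith) (by linarith)
  refine ⟨?_, Real.sin_le_one v, by linarith, by linarith, by linarith, by linarith⟩
  have := Real.sin_sq_add_cos_sq v
  have hc1 : -7/100 ≤ Real.cos v := by linarith
  have hc2 : Real.cos v ≤ 171/1000 := by linarith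
  nlinarith

lemma e1_mono_u (v : ℝ) (hv : v ∈ Set.Icc (7/5 : ℝ) (41/25)) :
    StrictMonoOn (fun u => e1 u v) (Set.Icc (17/5 : ℝ) (139/40)) := by
  apply strictMonoOn_of_deriv_pos (convex_Icc _ _)
  · unfold e1; fun_prop
  · intro u hu
    rw [interior_Icc] at hu
    obtain ⟨a1, a2, a3, a4, a5, a6, a7, a8⟩ := u_bounds u ⟨hu.1.le, hu.2.le⟩
    obtain ⟨b1, b2, b3, b4, b5, b6⟩ := v_bounds v hv
    have hE : HasDerivAt (fun u : ℝ => Real.exp (-u/5)) (Real.exp (-u/5) * (-1/5)) u :=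
      ((hasDerivAt_id u).neg.div_const 5).exp
    have hd : HasDerivAt (fun u => e1 u v) (1666 * Real.cos u * Real.cos v
        + (245 * (-Real.sin u - Real.exp (-u/5) * (-1/5)) - 385 * Real.cos u) * Real.sin v
        - 1666 * Real.cos u * Real.exp (-3 * v / 8)) u := by
      unfold e1
      exact ((((Real.hasDerivAt_sin u).const_mul 1666).mul_const _).add
        (((((Real.hasDerivAt_cos u).sub hE).const_mul 245).sub
          ((Real.hasDerivAt_sin u).const_mul 385)).mul_const _)).sub
        (((Real.hasDerivAt_sin u).const_mul 1666).mul_const _)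
    rw [hd.deriv]
    have p1 : 0 < (-Real.cos u) * (Real.exp (-3*v/8) - Real.cos v) :=
      mul_pos (by linarith) (by linarith)
    have p2 : 0 < (245 * (-Real.sin u - Real.exp (-u/5) * (-1/5)) - 385 * Real.cos u) * Real.sin v :=
      mul_pos (by linarith) (by linarith)
    linarith

lemma e1_mono_v (u : ℝ) (hu : u ∈ Set.Icc (17/5 : ℝ) (139/40)) :
    StrictMonoOn (fun v => e1 u v) (Set.Icc (7/5 : ℝ) (41/25)) := by
  apply strictMonoOn_of_deriv_pos (convex_Icc _ _)
  · unfold e1; fun_prop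
  · intro v hv
    rw [interior_Icc] at hv
    obtain ⟨a1, a2, a3, a4, a5, a6, a7, a8⟩ := u_bounds u hu
    obtain ⟨b1, b2, b3, b4, b5, b6⟩ := v_bounds v ⟨hv.1.le, hv.2.le⟩
    have hE : HasDerivAt (fun v : ℝ => Real.exp (-3*v/8)) (Real.exp (-3*v/8) * (-3*1/8)) v :=
      (((hasDerivAt_id v).const_mul (-3)).div_const 8).exp
    have hd : HasDerivAt (fun v => e1 u v) (1666 * Real.sin u * (-Real.sin v)
        + (245 * (Real.cos u - Real.exp (-u/5)) - 385 * Real.sin u) * Real.cos v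
        - 1666 * Real.sin u * (Real.exp (-3*v/8) * (-3*1/8))) v := by
      unfold e1
      exact (((Real.hasDerivAt_cos v).const_mul _).add
        ((Real.hasDerivAt_sin v).const_mul _)).sub (hE.const_mul _)
    rw [hd.deriv]
    -- main term
    have p1 : 0 ≤ (-Real.sin u - 18/100) * (Real.sin v - 3/8 * Real.exp (-3*v/8)
        - 75/100) := mul_nonneg (by linarith) (by linarith)
    have p2 : 0 ≤ (385*(-Real.sin u) + 245 * (Real.cos u - Real.exp (-u/5)) + 490)
      * (171/1000 - Real.cos v) := mul_nonneg (by linarith) (by linarith)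
    nlinarith

lemma e2_anti_u (v : ℝ) (hv : v ∈ Set.Icc (7/5 : ℝ) (41/25)) :
    StrictAntiOn (fun u => e2 u v) (Set.Icc (17/5 : ℝ) (139/40)) := by
  apply strictAntiOn_of_deriv_neg (convex_Icc _ _)
  · unfold e2; fun_prop
  · intro u hu
    rw [interior_Icc] at hu
    obtain ⟨a1, a2, a3, a4, a5, a6, a7, a8⟩ := u_bounds u ⟨hu.1.le, hu.2.le⟩
    obtain ⟨b1, b2, b3, b4, b5, b6⟩ := v_bounds v hv
    have hE : HasDerivAt (fun u : ℝ => Real.exp (-u/5)) (Real.exp (-u/5) * (-1/5)) u :=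
      ((hasDerivAt_id u).neg.div_const 5).exp
    have hF : HasDerivAt (fun u : ℝ => Real.exp (u/5)) (Real.exp (u/5) * (1/5)) u :=
      ((hasDerivAt_id u).div_const 5).exp
    have hd : HasDerivAt (fun u => e2 u v)
        ((-245 * (-Real.sin u - Real.exp (-u/5) * (-1/5)) + 385 * Real.cos u) * Real.cos v
        + 1666 * Real.cos u * Real.sin v
        + (-385 * Real.cos u - 245 * (-Real.sin u) + 245 * (Real.exp (u/5) * (1/5)))
          * Real.exp (-3 * v / 8)) u := by
      unfold e2
      exact ((((((Real.hasDerivAt_cos u).sub hE).const_mul (-245)).add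
          ((Real.hasDerivAt_sin u).const_mul 385)).mul_const _).add
        (((Real.hasDerivAt_sin u).const_mul 1666).mul_const _)).add
        (((((Real.hasDerivAt_sin u).const_mul (-385)).sub
          ((Real.hasDerivAt_cos u).const_mul 245)).add (hF.const_mul 245)).mul_const _)
    rw [hd.deriv]
    have p1 : 0 ≤ (-(-245 * (-Real.sin u - Real.exp (-u/5) * (-1/5)) + 385 * Real.cos u))
        * (Real.cos v + 7/100) := mul_nonneg (by linarith) (by linarith)
    have p2 : 0 ≤ (-Real.cos u) * (Real.sin v - 98/100) := mul_nonneg (by linarith) (by linarith)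
    have p3 : 0 ≤ (-385 * Real.cos u - 245 * (-Real.sin u) + 245 * (Real.exp (u/5) * (1/5)))
        * (6/10 - Real.exp (-3*v/8)) := mul_nonneg (by linarith) (by linarith)
    linarith

lemma e1_cont_v (u : ℝ) : Continuous (fun v => e1 u v) := by unfold e1; fun_prop
lemma e1_cont_u (v : ℝ) : Continuous (fun u => e1 u v) := by unfold e1; fun_prop
lemma e2_cont : Continuous (fun p : ℝ × ℝ => e2 p.1 p.2) := by unfold e2; fun_prop

lemma miranda (f g : ℝ → ℝ → ℝ) (a b c d : ℝ) (hab : a ≤ b) (hcd : c ≤ d)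
    (hC : c ∈ Set.Icc c d) (hD : d ∈ Set.Icc c d)
    (hmono : ∀ v ∈ Set.Icc c d, StrictMonoOn (fun u => f u v) (Set.Icc a b))
    (hcv : ∀ u, Continuous (fun v => f u v)) (hcu : ∀ v, Continuous (fun u => f u v))
    (hg : Continuous (fun p : ℝ × ℝ => g p.1 p.2))
    (left : ∀ v ∈ Set.Icc c d, f a v < 0) (right : ∀ v ∈ Set.Icc c d, 0 < f b v)
    (bot : ∀ u ∈ Set.Icc a b, 0 < g u c) (top : ∀ u ∈ Set.Icc a b, g u d < 0) :
    ∃ u v : ℝ, u ∈ Set.Ioo a b ∧ v ∈ Set.Ioo c d ∧ f u v = 0 ∧ g u v = 0 := by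
  have ex : ∀ v : ℝ, ∃ u : ℝ, v ∈ Set.Icc c d →
      u ∈ Set.Ioo a b ∧ f u v = 0 := by
    intro v
    by_cases hv : v ∈ Set.Icc c d
    · obtain ⟨u, hu, h⟩ := intermediate_value_Ioo hab
        (hcu v).continuousOn ⟨left v hv, right v hv⟩
      exact ⟨u, fun _ => ⟨hu, h⟩⟩
    · exact ⟨0, fun h => absurd h hv⟩
  choose φ hφ using ex
  have cont : ContinuousOn φ (Set.Icc c d) := by
    intro v hv
    obtain ⟨hm, hz⟩ := hφ v hv
    refine tendsto_order.2 ⟨fun t ht => ?_, fun t ht => ?_⟩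
    · have hb : max t a ∈ Set.Icc a b :=
        ⟨le_max_right _ _, (max_lt ht hm.1).le.trans hm.2.le⟩
      have hneg : f (max t a) v < 0 := by
        rw [← hz]; exact hmono v hv hb ⟨hm.1.le, hm.2.le⟩ (max_lt ht hm.1)
      have ev := ((hcv (max t a)).tendsto v).eventually (gt_mem_nhds hneg)
      filter_upwards [nhdsWithin_le_nhds ev, self_mem_nhdsWithin] with w hw hwI
      obtain ⟨hm', hz'⟩ := hφ w hwI
      rw [← hz'] at hw
      exact lt_of_le_of_lt (le_max_left _ _)
        (((hmono w hwI).lt_iff_lt hb ⟨hm'.1.le, hm'.2.le⟩).1 hw)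
    · have hb : min t b ∈ Set.Icc a b :=
        ⟨hm.1.le.trans (lt_min ht hm.2).le, min_le_right _ _⟩
      have hpos : 0 < f (min t b) v := by
        rw [← hz]; exact hmono v hv ⟨hm.1.le, hm.2.le⟩ hb (lt_min ht hm.2)
      have ev := ((hcv (min t b)).tendsto v).eventually (lt_mem_nhds hpos)
      filter_upwards [nhdsWithin_le_nhds ev, self_mem_nhdsWithin] with w hw hwI
      obtain ⟨hm', hz'⟩ := hφ w hwI
      rw [← hz'] at hw
      exact lt_of_lt_of_le
        (((hmono w hwI).lt_iff_lt ⟨hm'.1.le, hm'.2.le⟩ hb).1 hw) (min_le_left _ _)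
  have gc : ContinuousOn (fun v => g (φ v) v) (Set.Icc c d) :=
    hg.comp_continuousOn (cont.prodMk continuousOn_id)
  obtain ⟨v, hv, h⟩ := intermediate_value_Ioo' hcd gc
    ⟨top _ (Set.Ioo_subset_Icc_self (hφ _ hD).1), bot _ (Set.Ioo_subset_Icc_self (hφ _ hC).1)⟩
  obtain ⟨hm, hz⟩ := hφ v ⟨hv.1.le, hv.2.le⟩
  exact ⟨φ v, v, hm, hv, hz, h⟩

/-- Existence of a common zero of `e₁, e₂` in the open box
`(17/5, 139/40) × (7/5, 41/25)`, giving the first of the three limit cycles. -/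
theorem common_zero_B1 :
    ∃ u v : ℝ, u ∈ Set.Ioo (17/5 : ℝ) (139/40) ∧ v ∈ Set.Ioo (7/5 : ℝ) (41/25) ∧
      e1 u v = 0 ∧ e2 u v = 0 := by
  have hA : (17/5 : ℝ) ∈ Set.Icc (17/5 : ℝ) (139/40) := by constructor <;> norm_num
  have hB : (139/40 : ℝ) ∈ Set.Icc (17/5 : ℝ) (139/40) := by constructor <;> norm_num
  have hC : (7/5 : ℝ) ∈ Set.Icc (7/5 : ℝ) (41/25) := by constructor <;> norm_num
  have hD : (41/25 : ℝ) ∈ Set.Icc (7/5 : ℝ) (41/25) := by constructor <;> norm_num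
  have left : ∀ v ∈ Set.Icc (7/5 : ℝ) (41/25), e1 (17/5) v < 0 := fun v hv =>
    lt_of_le_of_lt ((e1_mono_v _ hA).monotoneOn hv hD hv.2) corner_e1_A
  have right : ∀ v ∈ Set.Icc (7/5 : ℝ) (41/25), 0 < e1 (139/40) v := fun v hv =>
    lt_of_lt_of_le corner_e1_B ((e1_mono_v _ hB).monotoneOn hC hv hv.1)
  have bot : ∀ u ∈ Set.Icc (17/5 : ℝ) (139/40), 0 < e2 u (7/5) := fun u hu =>
    lt_of_lt_of_le corner_e2_B ((e2_anti_u _ hC).antitoneOn hu hB hu.2)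
  have top : ∀ u ∈ Set.Icc (17/5 : ℝ) (139/40), e2 u (41/25) < 0 := fun u hu =>
    lt_of_le_of_lt ((e2_anti_u _ hD).antitoneOn hA hu hu.1) corner_e2_A
  exact miranda e1 e2 _ _ _ _ (by norm_num) (by norm_num) hC hD e1_mono_u e1_cont_v e1_cont_u e2_cont
    left right bot top
end
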